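/- arXiv:math/0005011 — 2 statements merged into one kernel-verified Lean document; each statement's English description precedes it below -/
import Mathlib

section
/- Let A be a symmetric linear relation in a Hilbert space H. For λ ∈ ℂ with Im λ > 0, the defect space E_λ(A) = {f ∈ H : (f, λ f) ∈ A*} has dimension independent of λ in the open upper half-plane; i.e. dim E_λ(A) = dim E_i(A) for all λ with Im λ > 0. -/
open scoped InnerProductSpace

noncomputable section

variable {H : Type*} [NormedAddCommGroup H] [InnerProductSpace ℂ H] [CompleteSpace H]

/-- The adjoint relation `A* = {(f,g) : ⟪f,v⟫ = ⟪g,u⟫ for all (u,v) ∈ A}`. -/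
def adjRel (A : Set (H × H)) : Set (H × H) :=
  {p | ∀ q ∈ A, ⟪p.1, q.2⟫_ℂ = ⟪p.2, q.1⟫_ℂ}

/-- The defect subspace `E_λ(A) = {f : (f, λ f) ∈ A*}` (as a span, it is already a
linear subspace). -/
def defectSpace (A : Set (H × H)) (lam : ℂ) : Submodule ℂ H :=
  Submodule.span ℂ {f : H | (f, lam • f) ∈ adjRel A}

/-- The range of the relation `A - conj μ`. -/
def ranRel (A : Submodule ℂ (H × H)) (mu : ℂ) : Submodule ℂ H :=
  A.map (LinearMap.snd ℂ H H - (starRingEnd ℂ mu) • LinearMap.fst ℂ H H)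

lemma mem_ranRel (A : Submodule ℂ (H × H)) (mu : ℂ) (w : H) :
    w ∈ ranRel A mu ↔ ∃ p ∈ A, p.2 - (starRingEnd ℂ mu) • p.1 = w := by
  simp only [ranRel, Submodule.mem_map, LinearMap.sub_apply, LinearMap.smul_apply,
    LinearMap.snd_apply, LinearMap.fst_apply]

lemma mem_ranRel_orth (A : Submodule ℂ (H × H)) (mu : ℂ) (f : H) :
    f ∈ (ranRel A mu)ᗮ ↔ ∀ p ∈ A, ⟪f, p.2⟫_ℂ = (starRingEnd ℂ mu) * ⟪f, p.1⟫_ℂ := by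
  rw [Submodule.mem_orthogonal']
  constructor
  · intro h p hp
    have := h _ ((mem_ranRel A mu _).2 ⟨p, hp, rfl⟩)
    rw [inner_sub_right, inner_smul_right] at this
    exact sub_eq_zero.1 this
  · intro h w hw
    obtain ⟨p, hp, rfl⟩ := (mem_ranRel A mu _).1 hw
    rw [inner_sub_right, inner_smul_right, h p hp, sub_self]

lemma defectSpace_eq (A : Submodule ℂ (H × H)) (mu : ℂ) :
    defectSpace (A : Set (H × H)) mu = (ranRel A mu)ᗮ := by
  have : {f : H | (f, mu • f) ∈ adjRel (A : Set (H × H))} = ((ranRel A mu)ᗮ : Set H) := by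
    ext f
    rw [SetLike.mem_coe, mem_ranRel_orth]
    simp only [adjRel, Set.mem_ofPred_eq, SetLike.mem_coe, inner_smul_left]
  rw [defectSpace, this, Submodule.span_eq]

lemma ranRel_bound (A : Submodule ℂ (H × H))
    (hsym : ∀ p ∈ A, ∀ q ∈ A, ⟪p.1, q.2⟫_ℂ = ⟪p.2, q.1⟫_ℂ) (mu : ℂ) (hmu : 0 < mu.im)
    (p : H × H) (hp : p ∈ A) :
    mu.im * ‖p.1‖ ≤ ‖p.2 - (starRingEnd ℂ mu) • p.1‖ := by
  have him : (⟪p.1, p.2⟫_ℂ).im = 0 := by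
    have h := hsym p hp p hp
    rw [← inner_conj_symm p.2 p.1] at h
    have := congrArg Complex.im h
    rw [Complex.conj_im] at this
    linarith
  have h1 : (⟪p.1, p.2 - (starRingEnd ℂ mu) • p.1⟫_ℂ).im = mu.im * ‖p.1‖ ^ 2 := by
    rw [inner_sub_right, inner_smul_right, Complex.sub_im, him,
      show ⟪p.1, p.1⟫_ℂ = ((‖p.1‖ ^ 2 : ℝ) : ℂ) by
        rw [inner_self_eq_norm_sq_to_K]; push_cast; rfl]
    rw [Complex.im_mul_ofReal,
      Complex.conj_im]
    ring
  have h2 : mu.im * ‖p.1‖ ^ 2 ≤ ‖p.1‖ * ‖p.2 - (starRingEnd ℂ mu) • p.1‖ := by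
    rw [← h1]
    exact (le_abs_self _).trans ((Complex.abs_im_le_norm _).trans (norm_inner_le_norm _ _))
  rcases (norm_nonneg p.1).eq_or_lt with h | h
  · rw [← h, mul_zero]; exact norm_nonneg _
  · refine le_of_mul_le_mul_left ?_ h
    linarith

lemma defect_rank_le (A : Submodule ℂ (H × H))
    (hsym : ∀ p ∈ A, ∀ q ∈ A, ⟪p.1, q.2⟫_ℂ = ⟪p.2, q.1⟫_ℂ) (lam mu : ℂ)
    (hmu : ‖lam - mu‖ < mu.im) :
    Module.rank ℂ (defectSpace (A : Set (H × H)) lam) ≤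
      Module.rank ℂ (defectSpace (A : Set (H × H)) mu) := by
  have hpos : 0 < mu.im := (norm_nonneg _).trans_lt hmu
  rw [defectSpace_eq, defectSpace_eq]
  let T : (ranRel A lam)ᗮ →ₗ[ℂ] (ranRel A mu)ᗮ :=
    ((ranRel A mu)ᗮ.orthogonalProjectionOnto : H →ₗ[ℂ] (ranRel A mu)ᗮ) ∘ₗ (ranRel A lam)ᗮ.subtype
  refine LinearMap.rank_le_of_injective T ?_
  rw [injective_iff_map_eq_zero]
  rintro ⟨f, hf⟩ h0
  have hf2 : f ∈ (ranRel A mu)ᗮᗮ := by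
    rw [← Submodule.orthogonalProjectionOnto_eq_zero_iff]
    exact h0
  rw [Submodule.orthogonal_orthogonal_eq_closure] at hf2
  have key : ∀ w ∈ closure (ranRel A mu : Set H),
      mu.im * ‖⟪f, w⟫_ℂ‖ ≤ ‖lam - mu‖ * ‖f‖ * ‖w‖ := by
    intro w hw
    refine closure_minimal (t := {w | mu.im * ‖⟪f, w⟫_ℂ‖ ≤ ‖lam - mu‖ * ‖f‖ * ‖w‖})
      ?_ ?_ hw
    · intro w hw
      obtain ⟨p, hp, rfl⟩ := (mem_ranRel A mu _).1 hw
      have hb := ranRel_bound A hsym mu hpos p hp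
      have h1 : ⟪f, p.2 - (starRingEnd ℂ mu) • p.1⟫_ℂ
          = (starRingEnd ℂ (lam - mu)) * ⟪f, p.1⟫_ℂ := by
        rw [inner_sub_right, inner_smul_right, (mem_ranRel_orth A lam f).1 hf p hp, map_sub]
        ring
      rw [Set.mem_ofPred_eq, h1, norm_mul, RCLike.norm_conj]
      calc mu.im * (‖lam - mu‖ * ‖⟪f, p.1⟫_ℂ‖)
          ≤ mu.im * (‖lam - mu‖ * (‖f‖ * ‖p.1‖)) := by
            gcongr; exact norm_inner_le_norm _ _
        _ = ‖lam - mu‖ * ‖f‖ * (mu.im * ‖p.1‖) := by ring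
        _ ≤ _ := by gcongr
    · exact isClosed_le (by fun_prop) (by fun_prop)
  have hk := key f hf2
  have hn : ‖⟪f, f⟫_ℂ‖ = ‖f‖ * ‖f‖ := by
    rw [inner_self_eq_norm_sq_to_K, norm_pow, RCLike.norm_ofReal, abs_norm, sq]
  rw [hn] at hk
  have : f = 0 := by
    by_contra hne
    have : 0 < ‖f‖ * ‖f‖ := by positivity
    nlinarith
  exact Subtype.ext this

/-- For a symmetric linear relation `A` in a Hilbert space `H`, the
dimension of the defect space `E_λ(A)` is constant on the open upper half-plane:
`dim E_λ(A) = dim E_i(A)` whenever `Im λ > 0`. -/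
theorem statement3 (A : Submodule ℂ (H × H))
    (hsym : ∀ p ∈ A, ∀ q ∈ A, ⟪p.1, q.2⟫_ℂ = ⟪p.2, q.1⟫_ℂ)
    (lam : ℂ) (hlam : 0 < lam.im) :
    Module.rank ℂ (defectSpace (A : Set (H × H)) lam) =
      Module.rank ℂ (defectSpace (A : Set (H × H)) Complex.I) := by
  have hconv : Convex ℝ {z : ℂ | 0 < z.im} := convex_halfSpace_im_gt 0
  refine hconv.isPreconnected.induction₂ (fun x y =>
    Module.rank ℂ (defectSpace (A : Set (H × H)) x) =
      Module.rank ℂ (defectSpace (A : Set (H × H)) y)) ?_ ?_ ?_ hlam ?_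
  · intro x hx
    have hx' : 0 < x.im := hx
    have h1 : ∀ᶠ y in nhds x, ‖x - y‖ < y.im :=
      ContinuousAt.eventually_lt (by fun_prop) (by fun_prop) (by simpa using hx')
    have h2 : ∀ᶠ y in nhds x, ‖y - x‖ < x.im :=
      ContinuousAt.eventually_lt (by fun_prop) (by fun_prop) (by simpa using hx')
    filter_upwards [nhdsWithin_le_nhds h1, nhdsWithin_le_nhds h2] with y hy1 hy2
    exact le_antisymm (defect_rank_le A hsym x y hy1) (defect_rank_le A hsym y x hy2)
  · intro x y z _ _ _ h h'
    exact h.trans h'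
  · intro x y _ _ h
    exact h.symm
  · simp

end
end

section
/- Let M be a connected complete Riemannian manifold and ϱ ≥ 1 a locally Lipschitz function such that ∫₀^∞ ϱ(γ(t))^{-1}|γ'(t)|dt = ∞ for every curve γ : [0,∞) → M leaving every compact set. Then there exists a sequence of compactly supported Lipschitz functions φₙ on M with 0 ≤ φₙ ≤ 1, |dφₙ| ≤ 1/(nϱ) a.e., and φₙ(x) → 1 pointwise for every x ∈ M. -/
open MeasureTheory Filter Set
open scoped ENNReal

noncomputable section

/-- One-sided mean value estimate. -/
lemma aux_mvt (h w : ℝ → ℝ) (hw : Continuous w) (δ : ℝ) (hδ : 0 < δ)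
    (hh : Continuous h)
    (H : ∀ s t, s < t → t - s ≤ δ → h t - h s ≤ (t - s) * max (w s) (w t))
    (a b : ℝ) (hab : a ≤ b) : h b - h a ≤ ∫ t in a..b, w t := by
  have key := image_le_of_liminf_slope_right_le_deriv_boundary (f := h) (a := a) (b := b)
    (B := fun x => h a + ∫ t in a..x, w t) (B' := w) hh.continuousOn (by simp)
    (by
      apply Continuous.continuousOn
      exact continuous_const.add
        (intervalIntegral.continuous_primitive (fun a b => hw.intervalIntegrable a b) a))
    (by
      intro x _
      exact ((intervalIntegral.integral_hasDerivAt_right (hw.intervalIntegrable _ _)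
        (hw.stronglyMeasurableAtFilter _ _) hw.continuousAt).const_add _).hasDerivWithinAt)
    (by
      intro x _ r hr
      apply Eventually.frequently
      have h1 : ∀ᶠ z in nhds x, w z < r := hw.continuousAt.eventually_lt_const hr
      have h2 : ∀ᶠ z in nhds x, z < x + δ := eventually_lt_nhds (by linarith)
      filter_upwards [nhdsWithin_le_nhds h1, nhdsWithin_le_nhds h2, self_mem_nhdsWithin]
        with z hz1 hz2 hz3
      have hz3 : x < z := hz3
      rw [slope_def_field, div_lt_iff₀ (by linarith)]
      have := H x z hz3 (by linarith)
      have hm : max (w x) (w z) < r := max_lt hr hz1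
      nlinarith)
  have := key (right_mem_Icc.2 hab)
  linarith

/-- Chains with steps at most `δ`, starting in `A`. -/
inductive AuxChain {M : Type*} [MetricSpace M] (ϱ : M → ℝ) (δ : ℝ) (A : Set M) : M → ℝ → Prop
  | base (x : M) (hx : x ∈ A) : AuxChain ϱ δ A x 0
  | step (x y : M) (C : ℝ) (hxy : dist x y ≤ δ) (h : AuxChain ϱ δ A y C) :
      AuxChain ϱ δ A x (C + dist x y * (ϱ y)⁻¹)

lemma aux_curve {M : Type*} [MetricSpace M] (ϱ : M → ℝ) (hϱ1 : ∀ x, 1 ≤ ϱ x) (δ : ℝ) (hδ : 0 < δ)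
    (A : Set M) (x : M) (C : ℝ) (h : AuxChain ϱ δ A x C) :
    0 ≤ C ∧ ∃ (γ : ℝ → M) (L : ℝ), 0 ≤ L ∧ γ 0 ∈ A ∧ (∀ t, L ≤ t → γ t = x) ∧
      (∀ s t, s ≤ t → dist (γ s) (γ t) ≤ t - s + δ) ∧
      Measurable (fun t => ENNReal.ofReal (ϱ (γ t))⁻¹) ∧
      ∫⁻ t in Ico 0 L, ENNReal.ofReal (ϱ (γ t))⁻¹ ≤ ENNReal.ofReal C := by
  induction h with
  | base x hx =>
    refine ⟨le_rfl, fun _ => x, 0, le_rfl, hx, fun _ _ => rfl, ?_, measurable_const, by simp⟩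
    intro s t hst
    simp only [dist_self]
    linarith
  | step x y C hxy h ih =>
    obtain ⟨hC, γ, L, hL, h0, hend, hpair, hmeas, hint⟩ := ih
    have hy : 0 < (ϱ y)⁻¹ := inv_pos.2 (by linarith [hϱ1 y])
    have hd : 0 ≤ dist x y := dist_nonneg
    have hdc : 0 ≤ dist x y * (ϱ y)⁻¹ := by positivity
    rcases eq_or_ne x y with rfl | hne
    · refine ⟨by linarith, γ, L, hL, h0, hend, hpair, hmeas, ?_⟩
      simpa using hint
    have hdpos : 0 < dist x y := dist_pos.2 hne
    refine ⟨by linarith, fun t => if t < L + dist x y then γ t else x, L + dist x y, by linarith,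
      ?_, ?_, ?_, ?_, ?_⟩
    · simp only
      rw [if_pos (by linarith)]
      exact h0
    · intro t ht
      simp only
      rw [if_neg (by linarith)]
    · intro s t hst
      simp only
      by_cases h1 : s < L + dist x y
      · by_cases h2 : t < L + dist x y
        · rw [if_pos h1, if_pos h2]
          exact hpair s t hst
        · rw [if_pos h1, if_neg h2]
          rcases le_total L s with h3 | h3
          · rw [hend s h3, dist_comm]
            linarith
          · have e1 := hpair s L h3
            rw [hend L le_rfl] at e1
            have := dist_triangle (γ s) y x
            rw [dist_comm y x] at this
            linarith
      · rw [if_neg h1, if_neg (by linarith), dist_self]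
        linarith
    · have : (fun t => ENNReal.ofReal (ϱ (if t < L + dist x y then γ t else x))⁻¹) =
          fun t => if t < L + dist x y then ENNReal.ofReal (ϱ (γ t))⁻¹
            else ENNReal.ofReal (ϱ x)⁻¹ := by
        ext t
        split_ifs <;> rfl
      rw [this]
      exact Measurable.ite measurableSet_Iio hmeas measurable_const
    · have e0 : ∫⁻ t in Ico 0 (L + dist x y),
          ENNReal.ofReal (ϱ (if t < L + dist x y then γ t else x))⁻¹ =
          ∫⁻ t in Ico 0 (L + dist x y), ENNReal.ofReal (ϱ (γ t))⁻¹ := by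
        apply setLIntegral_congr_fun measurableSet_Ico
        intro t ht
        simp only
        rw [if_pos ht.2]
      rw [e0, ← Ico_union_Ico_eq_Ico hL (by linarith : L ≤ L + dist x y)]
      refine (lintegral_union_le _ _ _).trans ?_
      have e1 : ∫⁻ t in Ico L (L + dist x y), ENNReal.ofReal (ϱ (γ t))⁻¹ =
          ENNReal.ofReal (dist x y * (ϱ y)⁻¹) := by
        rw [setLIntegral_congr_fun (g := fun _ => ENNReal.ofReal (ϱ y)⁻¹) measurableSet_Ico]
        · rw [setLIntegral_const, Real.volume_Ico, ← ENNReal.ofReal_mul hy.le]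
          congr 1
          ring
        · intro t ht
          simp only
          rw [hend t ht.1]
      rw [e1, ENNReal.ofReal_add hC hdc]
      gcongr

lemma aux_allInf {M : Type*} [MetricSpace M] [ProperSpace M]
    (ϱ : M → ℝ) (hϱ : Continuous ϱ) (hϱ1 : ∀ x, 1 ≤ ϱ x)
    (hdiv : ∀ γ : ℝ → M, LipschitzWith 1 γ → Tendsto γ atTop (cocompact M) →
      ∫⁻ t in Ioi (0 : ℝ), ENNReal.ofReal (ϱ (γ t))⁻¹ = ∞)
    (γ : ℝ → M) (hγ : LipschitzWith 1 γ) :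
      ∫⁻ t in Ioi (0 : ℝ), ENNReal.ofReal (ϱ (γ t))⁻¹ = ∞ := by
  by_cases ht : Tendsto γ atTop (cocompact M)
  · exact hdiv γ hγ ht
  rw [(hasBasis_cocompact).tendsto_right_iff] at ht
  push Not at ht
  obtain ⟨K, hK, hfreq⟩ := ht
  have hfreq : ∃ᶠ t in atTop, γ t ∈ K := by
    refine hfreq.mono fun t ht => ?_
    simpa using ht
  have hK' : IsCompact (Metric.cthickening 1 K) := hK.cthickening
  obtain ⟨B, hB⟩ := (hK'.image hϱ).bddAbove
  have hBb : ∀ x ∈ Metric.cthickening 1 K, ϱ x ≤ B := fun x hx => hB (mem_image_of_mem _ hx)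
  have hB1 : 0 < B := by
    obtain ⟨t, ht⟩ := hfreq.exists
    have := hBb _ (Metric.self_subset_cthickening K ht)
    linarith [hϱ1 (γ t)]
  set c : ℝ≥0∞ := ENNReal.ofReal B⁻¹ with hc
  have hc0 : c ≠ 0 := by
    rw [hc, Ne, ENNReal.ofReal_eq_zero, not_le]
    positivity
  have main : ∀ n : ℕ, ∃ T : ℝ, 0 ≤ T ∧
      (n : ℝ≥0∞) * c ≤ ∫⁻ t in Ioc 0 T, ENNReal.ofReal (ϱ (γ t))⁻¹ := by
    intro n
    induction n with
    | zero => exact ⟨0, le_rfl, by simp⟩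
    | succ n ih =>
      obtain ⟨T, hT, hTn⟩ := ih
      obtain ⟨t, htT, htK⟩ := (frequently_atTop.1 hfreq) T
      refine ⟨t + 1, by linarith, ?_⟩
      rw [← Ioc_union_Ioc_eq_Ioc (hT.trans htT) (by linarith : t ≤ t + 1),
        lintegral_union measurableSet_Ioc (Ioc_disjoint_Ioc_of_le le_rfl)]
      push_cast
      rw [add_mul, one_mul]
      refine add_le_add (hTn.trans (lintegral_mono_set (Ioc_subset_Ioc_right htT))) ?_
      calc c = ∫⁻ s in Ioc t (t + 1), c := by simp
        _ ≤ _ := by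
          apply setLIntegral_mono' measurableSet_Ioc
          intro s hs
          apply ENNReal.ofReal_le_ofReal
          apply inv_anti₀ (by linarith [hϱ1 (γ s)])
          apply hBb
          apply Metric.mem_cthickening_of_dist_le _ (γ t) _ _ htK
          have := hγ.dist_le_mul s t
          rw [Real.dist_eq, abs_of_nonneg (by linarith [hs.1])] at this
          simp only [NNReal.coe_one, one_mul] at this
          linarith [hs.2]
  rw [eq_top_iff]
  have hle : ∀ n : ℕ, (n : ℝ≥0∞) * c ≤ ∫⁻ t in Ioi (0 : ℝ), ENNReal.ofReal (ϱ (γ t))⁻¹ := by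
    intro n
    obtain ⟨T, hT, h⟩ := main n
    exact h.trans (lintegral_mono_set Ioc_subset_Ioi_self)
  rw [← ENNReal.top_mul hc0, ← ENNReal.iSup_natCast, ENNReal.iSup_mul]
  exact iSup_le hle

lemma aux_proper {M : Type*} [MetricSpace M] [ProperSpace M]
    (ϱ : M → ℝ) (hϱ : Continuous ϱ) (hϱ1 : ∀ x, 1 ≤ ϱ x)
    (hinf : ∀ γ : ℝ → M, LipschitzWith 1 γ →
      ∫⁻ t in Ioi (0 : ℝ), ENNReal.ofReal (ϱ (γ t))⁻¹ = ∞)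
    (x0 : M) (r C : ℝ) :
    ∃ δ > 0, ∃ R : ℝ, ∀ x C', AuxChain ϱ δ (Metric.closedBall x0 r) x C' → C' < C →
      dist x x0 ≤ R := by
  by_contra hcon
  push Not at hcon
  have hδ : ∀ k : ℕ, (0 : ℝ) < 1 / ((k : ℝ) + 1) := fun k => by positivity
  have hδ1 : ∀ k : ℕ, 1 / ((k : ℝ) + 1) ≤ 1 := fun k => by
    rw [div_le_one (by positivity)]
    linarith [(Nat.cast_nonneg k : (0 : ℝ) ≤ k)]
  have hδ0 : Tendsto (fun k : ℕ => 1 / ((k : ℝ) + 1)) atTop (nhds 0) :=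
    tendsto_one_div_add_atTop_nhds_zero_nat
  choose x C' hch hC' hfar using fun k : ℕ => hcon (1 / ((k : ℝ) + 1)) (hδ k) k
  choose hCpos γ L hL h0 hend hpair hmeas hint using
    fun k => aux_curve ϱ hϱ1 _ (hδ k) _ _ _ (hch k)
  have hpair' : ∀ k s t, dist (γ k s) (γ k t) ≤ |s - t| + 1 / ((k : ℝ) + 1) := by
    intro k s t
    rcases le_total s t with h | h
    · rw [abs_sub_comm, abs_of_nonneg (by linarith)]
      exact hpair k s t h
    · rw [dist_comm, abs_of_nonneg (by linarith)]
      exact hpair k t s h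
  have hLk : ∀ k : ℕ, (k : ℝ) - r - 1 ≤ L k := by
    intro k
    have e1 := hpair k 0 (L k) (hL k)
    rw [hend k (L k) le_rfl] at e1
    have e2 := Metric.mem_closedBall.1 (h0 k)
    have e3 := dist_triangle (x k) (γ k 0) x0
    rw [dist_comm (x k) (γ k 0)] at e3
    have e4 := hfar k
    have e5 := hδ1 k
    linarith
  obtain ⟨g, -, ψ, hψ, hlim⟩ := (isCompact_univ_pi
    (fun q : ℚ => isCompact_closedBall x0 (r + |(q : ℝ)| + 1))).tendsto_subseq
    (x := fun k (q : ℚ) => γ k (q : ℝ)) (by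
      intro k q _
      have e1 := hpair' k q 0
      rw [sub_zero] at e1
      have e2 := Metric.mem_closedBall.1 (h0 k)
      have e3 := dist_triangle (γ k q) (γ k 0) x0
      have e5 := hδ1 k
      rw [Metric.mem_closedBall]
      linarith)
  have hlimq : ∀ q : ℚ, Tendsto (fun k => γ (ψ k) (q : ℝ)) atTop (nhds (g q)) :=
    fun q => (tendsto_pi_nhds.1 hlim) q
  have hδψ : Tendsto (fun k : ℕ => 1 / ((ψ k : ℝ) + 1)) atTop (nhds 0) :=
    hδ0.comp hψ.tendsto_atTop
  have hconv : ∀ t : ℝ, ∃ y, Tendsto (fun k => γ (ψ k) t) atTop (nhds y) := by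
    intro t
    apply cauchySeq_tendsto_of_complete
    rw [Metric.cauchySeq_iff]
    intro ε hε
    obtain ⟨q, hq1, hq2⟩ := exists_rat_btwn (show t < t + ε / 8 by linarith)
    obtain ⟨N1, hN1⟩ := Metric.cauchySeq_iff.1 (hlimq q).cauchySeq (ε / 8) (by linarith)
    obtain ⟨N2, hN2⟩ := eventually_atTop.1
      (hδψ.eventually_lt_const (show (0 : ℝ) < ε / 8 by linarith))
    refine ⟨max N1 N2, fun m hm n hn => ?_⟩
    have a1 := hN1 m (le_of_max_le_left hm) n (le_of_max_le_left hn)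
    have a2 := hN2 m (le_of_max_le_right hm)
    have a3 := hN2 n (le_of_max_le_right hn)
    have a4 := hpair' (ψ m) t q
    have a5 := hpair' (ψ n) q t
    rw [abs_sub_comm, abs_of_nonneg (by linarith)] at a4
    rw [abs_of_nonneg (by linarith)] at a5
    have a6 := dist_triangle4 (γ (ψ m) t) (γ (ψ m) q) (γ (ψ n) q) (γ (ψ n) t)
    linarith
  choose G hG using hconv
  have hGlip : LipschitzWith 1 G := by
    apply LipschitzWith.of_dist_le_mul
    intro s t
    have l1 := (hG s).dist (hG t)
    have l2 : Tendsto (fun k => |s - t| + 1 / ((ψ k : ℝ) + 1)) atTop (nhds (|s - t| + 0)) :=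
      tendsto_const_nhds.add hδψ
    have := le_of_tendsto_of_tendsto' l1 l2 (fun k => hpair' (ψ k) s t)
    simpa [Real.dist_eq] using this
  have hI := hinf G hGlip
  have hfat := lintegral_liminf_le (μ := volume) (u := atTop)
    (f := fun k : ℕ => (Ico 0 (L (ψ k))).indicator
      (fun t => ENNReal.ofReal (ϱ (γ (ψ k) t))⁻¹))
    (fun k => (hmeas (ψ k)).indicator measurableSet_Ico)
  have hup : liminf (fun k : ℕ => ∫⁻ t, (Ico 0 (L (ψ k))).indicator
      (fun t => ENNReal.ofReal (ϱ (γ (ψ k) t))⁻¹) t) atTop ≤ ENNReal.ofReal C := by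
    refine liminf_le_of_frequently_le' (Frequently.of_forall fun k => ?_)
    rw [lintegral_indicator measurableSet_Ico]
    exact (hint (ψ k)).trans (ENNReal.ofReal_le_ofReal (hC' _).le)
  have hlow : ∫⁻ t in Ioi (0 : ℝ), ENNReal.ofReal (ϱ (G t))⁻¹ ≤
      ∫⁻ t, liminf (fun k : ℕ => (Ico 0 (L (ψ k))).indicator
      (fun t => ENNReal.ofReal (ϱ (γ (ψ k) t))⁻¹) t) atTop := by
    rw [← lintegral_indicator measurableSet_Ioi]
    apply lintegral_mono
    intro t
    simp only
    by_cases ht : t ∈ Ioi (0 : ℝ)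
    · rw [indicator_of_mem ht]
      apply le_of_eq
      symm
      apply Tendsto.liminf_eq
      have l1 : Tendsto (fun k => ENNReal.ofReal (ϱ (γ (ψ k) t))⁻¹) atTop
          (nhds (ENNReal.ofReal (ϱ (G t))⁻¹)) := by
        apply ENNReal.tendsto_ofReal
        apply Tendsto.inv₀ ((hϱ.tendsto _).comp (hG t))
        linarith [hϱ1 (G t)]
      refine l1.congr' ?_
      obtain ⟨N, hN⟩ := exists_nat_gt (t + r + 1)
      filter_upwards [eventually_ge_atTop N] with k hk
      rw [indicator_of_mem]
      refine ⟨le_of_lt ht, ?_⟩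
      have b1 := hLk (ψ k)
      have b2 : (N : ℝ) ≤ ψ k := by exact_mod_cast hk.trans (hψ.id_le k)
      linarith
    · rw [indicator_of_notMem ht]
      exact zero_le
  have := hlow.trans (hfat.trans hup)
  rw [hI, top_le_iff] at this
  exact ENNReal.ofReal_ne_top this

lemma aux_phi {M : Type*} [MetricSpace M] [ProperSpace M]
    (ϱ : M → ℝ) (hϱ : Continuous ϱ) (hϱ1 : ∀ x, 1 ≤ ϱ x)
    (hinf : ∀ γ : ℝ → M, LipschitzWith 1 γ →
      ∫⁻ t in Ioi (0 : ℝ), ENNReal.ofReal (ϱ (γ t))⁻¹ = ∞)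
    (x0 : M) (r C : ℝ) (hC : 1 ≤ C) :
    ∃ φ : M → ℝ, HasCompactSupport φ ∧ LocallyLipschitz φ ∧ (∀ x, 0 ≤ φ x ∧ φ x ≤ 1) ∧
      (∀ γ : ℝ → M, LipschitzWith 1 γ → ∀ a b : ℝ, a ≤ b →
        |φ (γ b) - φ (γ a)| ≤ C⁻¹ * ∫ t in a..b, (ϱ (γ t))⁻¹) ∧
      (∀ x ∈ Metric.closedBall x0 r, φ x = 1) := by
  obtain ⟨δ, hδ, R, hR⟩ := aux_proper ϱ hϱ hϱ1 hinf x0 r C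
  set S : M → Set ℝ := fun x => insert C {c | AuxChain ϱ δ (Metric.closedBall x0 r) x c} with hS
  have hS0 : ∀ x, ∀ c ∈ S x, 0 ≤ c := by
    rintro x c (rfl | hc)
    · linarith
    · exact (aux_curve ϱ hϱ1 δ hδ _ _ _ hc).1
  have hbdd : ∀ x, BddBelow (S x) := fun x => ⟨0, fun c hc => hS0 x c hc⟩
  have hne : ∀ x, (S x).Nonempty := fun x => ⟨C, mem_insert _ _⟩
  set f : M → ℝ := fun x => sInf (S x) with hf
  have hf0 : ∀ x, 0 ≤ f x := fun x => le_csInf (hne x) (hS0 x)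
  have hfC : ∀ x, f x ≤ C := fun x => csInf_le (hbdd x) (mem_insert _ _)
  have hball : ∀ x ∈ Metric.closedBall x0 r, f x = 0 := fun x hx =>
    le_antisymm (csInf_le (hbdd x) (mem_insert_of_mem _ (AuxChain.base x hx))) (hf0 x)
  have hfar : ∀ x, R < dist x x0 → f x = C := by
    intro x hx
    refine le_antisymm (hfC x) (le_csInf (hne x) ?_)
    rintro c (rfl | hc)
    · exact le_rfl
    · by_contra hlt
      linarith [hR x c hc (not_le.1 hlt)]
  have hinv : ∀ x, 0 < (ϱ x)⁻¹ := fun x => inv_pos.2 (by linarith [hϱ1 x])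
  have hinv1 : ∀ x, (ϱ x)⁻¹ ≤ 1 := fun x => inv_le_one_of_one_le₀ (hϱ1 x)
  have hstep : ∀ x y, dist x y ≤ δ → f x ≤ f y + dist x y * (ϱ y)⁻¹ := by
    intro x y hxy
    rw [← sub_le_iff_le_add]
    apply le_csInf (hne y)
    rintro c (rfl | hc)
    · have := hfC x
      have : 0 ≤ dist x y * (ϱ y)⁻¹ := mul_nonneg dist_nonneg (hinv y).le
      linarith
    · rw [sub_le_iff_le_add]
      exact csInf_le (hbdd x) (mem_insert_of_mem _ (AuxChain.step x y c hxy hc))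
  have hstep1 : ∀ x y, dist x y ≤ δ → f x ≤ f y + dist x y := by
    intro x y hxy
    have := hstep x y hxy
    have : dist x y * (ϱ y)⁻¹ ≤ dist x y := mul_le_of_le_one_right dist_nonneg (hinv1 y)
    linarith
  have hCp : 0 < C := by linarith
  have hlip : LocallyLipschitz f := by
    intro x
    refine ⟨1, Metric.ball x (δ / 2), Metric.ball_mem_nhds _ (by linarith), ?_⟩
    apply LipschitzOnWith.of_dist_le_mul
    intro y hy z hz
    have hy := Metric.mem_ball.1 hy
    have hz := Metric.mem_ball'.1 hz
    have hyz : dist y z ≤ δ := by linarith [dist_triangle y x z]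
    have a1 := hstep1 y z hyz
    have a2 := hstep1 z y (by rwa [dist_comm])
    rw [dist_comm z y] at a2
    rw [Real.dist_eq, NNReal.coe_one, one_mul, abs_le]
    constructor <;> linarith
  refine ⟨fun x => 1 - C⁻¹ * f x, ?_, ?_, ?_, ?_, ?_⟩
  · apply HasCompactSupport.of_support_subset_isCompact (isCompact_closedBall x0 R)
    intro x hx
    rw [Metric.mem_closedBall]
    by_contra hlt
    apply hx
    simp only
    rw [hfar x (not_le.1 hlt), inv_mul_cancel₀ hCp.ne', sub_self]
  · have hg : LipschitzWith 1 (fun t : ℝ => 1 - C⁻¹ * t) := by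
      apply LipschitzWith.of_dist_le_mul
      intro s t
      rw [Real.dist_eq, Real.dist_eq, NNReal.coe_one, one_mul,
        show 1 - C⁻¹ * s - (1 - C⁻¹ * t) = C⁻¹ * (t - s) by ring, abs_mul,
        abs_of_pos (inv_pos.2 hCp), abs_sub_comm]
      exact mul_le_of_le_one_left (abs_nonneg _) (inv_le_one_of_one_le₀ hC)
    exact hg.locallyLipschitz.comp hlip
  · intro x
    have b1 : 0 ≤ C⁻¹ * f x := mul_nonneg (inv_pos.2 hCp).le (hf0 x)
    have b2 : C⁻¹ * f x ≤ 1 := by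
      rw [← inv_mul_cancel₀ hCp.ne']
      exact mul_le_mul_of_nonneg_left (hfC x) (inv_pos.2 hCp).le
    constructor <;> linarith
  · intro γ hγ a b hab
    have hw : Continuous fun t => (ϱ (γ t))⁻¹ :=
      (hϱ.comp hγ.continuous).inv₀ (fun t => by
        have := hϱ1 (γ t)
        simp only [Function.comp]
        linarith)
    have hfc : Continuous fun t => f (γ t) := hlip.continuous.comp hγ.continuous
    have hd : ∀ s t : ℝ, s < t → dist (γ s) (γ t) ≤ t - s := by
      intro s t hst
      have := hγ.dist_le_mul s t
      rw [NNReal.coe_one, one_mul, dist_comm s t, Real.dist_eq, abs_of_pos (by linarith)] at this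
      exact this
    have u1 := aux_mvt (fun t => f (γ t)) _ hw δ hδ hfc (by
      intro s t hst hle
      have c1 := hd s t hst
      have c2 := hstep (γ t) (γ s) (by rw [dist_comm]; linarith)
      rw [dist_comm] at c2
      have c3 : dist (γ s) (γ t) * (ϱ (γ s))⁻¹ ≤
          (t - s) * max (ϱ (γ s))⁻¹ (ϱ (γ t))⁻¹ :=
        mul_le_mul c1 (le_max_left _ _) (hinv _).le (by linarith)
      linarith) a b hab
    have u2 := aux_mvt (fun t => - f (γ t)) _ hw δ hδ hfc.neg (by
      intro s t hst hle
      have c1 := hd s t hst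
      have c2 := hstep (γ s) (γ t) (by linarith)
      have c3 : dist (γ s) (γ t) * (ϱ (γ t))⁻¹ ≤
          (t - s) * max (ϱ (γ s))⁻¹ (ϱ (γ t))⁻¹ :=
        mul_le_mul c1 (le_max_right _ _) (hinv _).le (by linarith)
      linarith) a b hab
    rw [show 1 - C⁻¹ * f (γ b) - (1 - C⁻¹ * f (γ a)) = C⁻¹ * (f (γ a) - f (γ b)) by ring, abs_mul,
        abs_of_pos (inv_pos.2 hCp)]
    apply mul_le_mul_of_nonneg_left _ (inv_pos.2 hCp).le
    rw [abs_le]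
    constructor <;> linarith
  · intro x hx
    simp only
    rw [hball x hx]
    ring

/-- Let `M` be a connected complete (hence proper) Riemannian
manifold, viewed as a metric space, and `ϱ ≥ 1` a locally Lipschitz function such that
`∫₀^∞ ϱ(γ(t))⁻¹ |γ'(t)| dt = ∞` for every curve `γ` leaving every compact set
(equivalently, along every 1-Lipschitz, e.g. unit-speed, escaping curve the integral
`∫ ϱ(γ(t))⁻¹ dt` diverges). Then there are compactly supported Lipschitz functions
`φₙ` with `0 ≤ φₙ ≤ 1`, `|dφₙ| ≤ 1/(nϱ)` (in the upper-gradient sense along curves),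
and `φₙ → 1` pointwise. -/
theorem statement15 {M : Type*} [MetricSpace M] [ProperSpace M] [ConnectedSpace M]
    (ϱ : M → ℝ) (hϱ_lip : LocallyLipschitz ϱ) (hϱ1 : ∀ x, 1 ≤ ϱ x)
    (hdiv : ∀ γ : ℝ → M, LipschitzWith 1 γ → Tendsto γ atTop (cocompact M) →
      ∫⁻ t in Ioi (0 : ℝ), ENNReal.ofReal (ϱ (γ t))⁻¹ = ∞) :
    ∃ φ : ℕ → M → ℝ,
      (∀ n, HasCompactSupport (φ n)) ∧
      (∀ n, LocallyLipschitz (φ n)) ∧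
      (∀ n x, 0 ≤ φ n x ∧ φ n x ≤ 1) ∧
      (∀ n : ℕ, 1 ≤ n → ∀ γ : ℝ → M, LipschitzWith 1 γ → ∀ a b : ℝ, a ≤ b →
        |φ n (γ b) - φ n (γ a)| ≤ (n : ℝ)⁻¹ * ∫ t in a..b, (ϱ (γ t))⁻¹) ∧
      (∀ x, Tendsto (fun n => φ n x) atTop (nhds 1)) := by
  have hϱ : Continuous ϱ := hϱ_lip.continuous
  have hinf := aux_allInf ϱ hϱ hϱ1 hdiv
  obtain ⟨x0⟩ : Nonempty M := inferInstance
  choose φ h1 h2 h3 h4 h5 using fun n : ℕ => aux_phi ϱ hϱ hϱ1 hinf x0 n ((n : ℝ) + 1)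
    (by linarith [(Nat.cast_nonneg n : (0 : ℝ) ≤ n)])
  refine ⟨φ, h1, h2, h3, ?_, ?_⟩
  · intro n hn γ hγ a b hab
    refine (h4 n γ hγ a b hab).trans ?_
    have hn' : (0 : ℝ) < n := by exact_mod_cast hn
    apply mul_le_mul_of_nonneg_right
    · exact inv_anti₀ hn' (by linarith)
    · apply intervalIntegral.integral_nonneg hab
      intro t _
      exact inv_nonneg.2 (by linarith [hϱ1 (γ t)])
  · intro x
    obtain ⟨N, hN⟩ := exists_nat_ge (dist x x0)
    apply tendsto_const_nhds.congr'
    filter_upwards [eventually_ge_atTop N] with n hn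
    have : (N : ℝ) ≤ n := by exact_mod_cast hn
    exact (h5 n x (Metric.mem_closedBall.2 (hN.trans this))).symm

end
end
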